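/- No fragment F of intuitionistic propositional logic containing → has a finite semantics. That is, if → ∈ F, there is no algebra with finite universe V carrying an operation for each connective in F, together with a subset D ⊆ V, such that for all Γ ∪ {φ} ⊆ 𝔉_F one has Γ ⊢_F φ iff Γ ⊨_{A,D} φ. In particular, intuitionistic propositional logic itself (F = {∧, ∨, →, ¬}) has no finite semantics (Gödel's theorem). -/

import Mathlib

/-- The four propositional connectives. -/
inductive Conn : Type
  | conj | disj | impl | nega
deriving DecidableEq

/-- Propositional formulas over countably many letters `p₀, p₁, …`. -/
inductive PropForm : Type
  | var : ℕ → PropForm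
  | and : PropForm → PropForm → PropForm
  | or : PropForm → PropForm → PropForm
  | imp : PropForm → PropForm → PropForm
  | neg : PropForm → PropForm

/-- The set of connectives occurring in a formula. -/
def PropForm.conns : PropForm → Set Conn
  | .var _ => ∅
  | .and a b => insert .conj (a.conns ∪ b.conns)
  | .or a b => insert .disj (a.conns ∪ b.conns)
  | .imp a b => insert .impl (a.conns ∪ b.conns)
  | .neg a => insert .nega a.conns

/-- `φ ∈ 𝔉_F` : the formula `φ` uses only connectives belonging to the fragment `F`. -/
def InFrag (F : Set Conn) (φ : PropForm) : Prop := φ.conns ⊆ F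

/-- Derivability `Γ ⊢_F φ` for the fragment `F`: the least relation closed under
membership, monotonicity, cut, and the two directions of the rules
(R∧), (R∨), (R→), (R¬I), (R¬E) for the connectives in `F`. -/
inductive Deriv (F : Set Conn) : Set PropForm → PropForm → Prop
  | mem {Γ : Set PropForm} {φ : PropForm} : φ ∈ Γ → Deriv F Γ φ
  | mono {Γ : Set PropForm} {φ ψ : PropForm} : Deriv F Γ φ → Deriv F (insert ψ Γ) φ
  | cut {Γ Δ : Set PropForm} {φ ψ : PropForm} :
      Deriv F Γ φ → Deriv F (insert φ Δ) ψ → Deriv F (Γ ∪ Δ) ψ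
  | andI {Γ : Set PropForm} {φ ψ : PropForm} :
      Conn.conj ∈ F → Deriv F Γ φ → Deriv F Γ ψ → Deriv F Γ (.and φ ψ)
  | andE1 {Γ : Set PropForm} {φ ψ : PropForm} :
      Conn.conj ∈ F → Deriv F Γ (.and φ ψ) → Deriv F Γ φ
  | andE2 {Γ : Set PropForm} {φ ψ : PropForm} :
      Conn.conj ∈ F → Deriv F Γ (.and φ ψ) → Deriv F Γ ψ
  | orI {Γ : Set PropForm} {φ ψ χ : PropForm} :
      Conn.disj ∈ F → Deriv F (insert φ Γ) χ → Deriv F (insert ψ Γ) χ →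
      Deriv F (insert (.or φ ψ) Γ) χ
  | orE1 {Γ : Set PropForm} {φ ψ χ : PropForm} :
      Conn.disj ∈ F → Deriv F (insert (.or φ ψ) Γ) χ → Deriv F (insert φ Γ) χ
  | orE2 {Γ : Set PropForm} {φ ψ χ : PropForm} :
      Conn.disj ∈ F → Deriv F (insert (.or φ ψ) Γ) χ → Deriv F (insert ψ Γ) χ
  | impI {Γ : Set PropForm} {φ ψ : PropForm} :
      Conn.impl ∈ F → Deriv F (insert φ Γ) ψ → Deriv F Γ (.imp φ ψ)
  | impE {Γ : Set PropForm} {φ ψ : PropForm} :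
      Conn.impl ∈ F → Deriv F Γ (.imp φ ψ) → Deriv F (insert φ Γ) ψ
  | negI {Γ : Set PropForm} {φ ψ : PropForm} :
      Conn.nega ∈ F → Deriv F (insert φ Γ) ψ → Deriv F (insert φ Γ) (.neg ψ) →
      Deriv F Γ (.neg φ)
  | negE {Γ : Set PropForm} {φ ψ : PropForm} :
      Conn.nega ∈ F → Deriv F Γ φ → Deriv F Γ (.neg φ) → Deriv F Γ ψ

/-- An algebra interpreting the connectives on a carrier `V`. -/
structure Alg (V : Type) where
  and : V → V → V
  or : V → V → V
  imp : V → V → V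
  neg : V → V

/-- The homomorphic extension of an assignment `v` of letters. -/
def Alg.eval {V : Type} (A : Alg V) (v : ℕ → V) : PropForm → V
  | .var n => v n
  | .and a b => A.and (A.eval v a) (A.eval v b)
  | .or a b => A.or (A.eval v a) (A.eval v b)
  | .imp a b => A.imp (A.eval v a) (A.eval v b)
  | .neg a => A.neg (A.eval v a)

/-- Semantic consequence `Γ ⊨_{A,D} φ`. -/
def SemConseq {V : Type} (A : Alg V) (D : Set V) (Γ : Set PropForm) (φ : PropForm) : Prop :=
  ∀ v : ℕ → V, (∀ ψ ∈ Γ, A.eval v ψ ∈ D) → A.eval v φ ∈ D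

/-- The fragment `F` has a finite semantics. -/
def HasFiniteSemantics (F : Set Conn) : Prop :=
  ∃ (V : Type) (_ : Fintype V) (A : Alg V) (D : Set V),
    ∀ (Γ : Set PropForm) (φ : PropForm),
      (∀ ψ ∈ Γ, InFrag F ψ) → InFrag F φ →
      (Deriv F Γ φ ↔ SemConseq A D Γ φ)

/-- `φ ∨̇ ψ = (φ → ψ) → ψ`. -/
def dvee (a b : PropForm) : PropForm := .imp (.imp a b) b

/-- Left-associated iterated `∨̇` of a list of formulas. -/
def bigDvee : List PropForm → PropForm
  | [] => .var 0
  | a :: rest => rest.foldl dvee a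

/-- Left-associated iterated `∨` of a list of formulas. -/
def bigOrF : List PropForm → PropForm
  | [] => .var 0
  | a :: rest => rest.foldl PropForm.or a

/-- All pairs `(i, j)` with `1 ≤ i < j ≤ n+1`. -/
def pairs (n : ℕ) : List (ℕ × ℕ) :=
  (List.range' 2 n).flatMap fun j => (List.range' 1 (j - 1)).map fun i => (i, j)

/-- `α_n = ∨̇_{1 ≤ i < j ≤ n+1} (p_j → p_i)`. -/
def alphaImp (n : ℕ) : PropForm :=
  bigDvee ((pairs n).map fun p => .imp (.var p.2) (.var p.1))

/-- `α_n = ⋁_{1 ≤ i < j ≤ n+1} ¬¬(¬p_i ∨ p_j)`. -/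
def alphaOrNeg (n : ℕ) : PropForm :=
  bigOrF ((pairs n).map fun p => .neg (.neg (.or (.neg (.var p.1)) (.var p.2))))

/-- Two-valued Boolean evaluation. -/
def evalBool (v : ℕ → Bool) : PropForm → Bool
  | .var n => v n
  | .and a b => evalBool v a && evalBool v b
  | .or a b => evalBool v a || evalBool v b
  | .imp a b => !evalBool v a || evalBool v b
  | .neg a => !evalBool v a

/-- Classical (two-valued) consequence `Γ ⊢_c φ`. -/
def ClassConseq (Γ : Set PropForm) (φ : PropForm) : Prop :=
  ∀ v : ℕ → Bool, (∀ ψ ∈ Γ, evalBool v ψ = true) → evalBool v φ = true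

/-- The two-element Boolean algebra `𝟐`. -/
def alg2 : Alg Bool where
  and a b := a && b
  or a b := a || b
  imp a b := !a || b
  neg a := !a

/-- The three-element algebra `𝟑` on the chain `0 < 1/2 < 1` (coded as `0 < 1 < 2` in `Fin 3`),
with meet `min` and meet complement `¬0 = 1`, `¬(1/2) = ¬1 = 0` (its `or`/`imp` are those of the
3-element Heyting chain). -/
def alg3 : Alg (Fin 3) where
  and a b := min a b
  or a b := max a b
  imp a b := if a ≤ b then 2 else b
  neg a := if a = 0 then 2 else 0

/-- The `(n+1)`-element Heyting chain, coded on `Fin (n+1)` (so `k` codes the element `k+1`). -/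
def chainAlg (n : ℕ) : Alg (Fin (n + 1)) where
  and a b := min a b
  or a b := max a b
  imp a b := if a ≤ b then Fin.last n else b
  neg a := if a = 0 then Fin.last n else 0

/-- The value of a formula in a Heyting algebra under an assignment of the letters. -/
def heytingEval {H : Type*} [HeytingAlgebra H] (v : ℕ → H) : PropForm → H
  | .var n => v n
  | .and a b => heytingEval v a ⊓ heytingEval v b
  | .or a b => heytingEval v a ⊔ heytingEval v b
  | .imp a b => heytingEval v a ⇨ heytingEval v b
  | .neg a => (heytingEval v a)ᶜ

/-- Derivability is sound for Heyting algebras: every lower bound of the values of the premises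
lies below the value of the conclusion. -/
theorem Deriv.le_heytingEval {H : Type*} [HeytingAlgebra H] (v : ℕ → H) {F : Set Conn}
    {Γ : Set PropForm} {φ : PropForm} (h : Deriv F Γ φ) :
    ∀ c : H, (∀ ψ ∈ Γ, c ≤ heytingEval v ψ) → c ≤ heytingEval v φ := by
  have weaken : ∀ {Γ : Set PropForm} {χ : PropForm} {c d : H},
      (∀ ψ ∈ Γ, c ≤ heytingEval v ψ) → d ≤ c → d ≤ heytingEval v χ →
      ∀ ψ ∈ insert χ Γ, d ≤ heytingEval v ψ := by
    rintro Γ χ c d hc hd hχ ψ (rfl | hψ)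
    exacts [hχ, hd.trans (hc ψ hψ)]
  induction h with
  | mem h => exact fun c hc => hc _ h
  | mono _ ih => exact fun c hc => ih c fun ψ hψ => hc ψ (.inr hψ)
  | cut _ _ ih₁ ih₂ =>
    exact fun c hc => ih₂ c <| weaken (fun ψ hψ => hc ψ (.inr hψ)) le_rfl <|
      ih₁ c fun ψ hψ => hc ψ (.inl hψ)
  | andI _ _ _ ih₁ ih₂ => exact fun c hc => le_inf (ih₁ c hc) (ih₂ c hc)
  | andE1 _ _ ih => exact fun c hc => (ih c hc).trans inf_le_left
  | andE2 _ _ ih => exact fun c hc => (ih c hc).trans inf_le_right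
  | @orI Γ φ ψ χ _ _ _ ih₁ ih₂ =>
    intro c hc
    have hΓ : ∀ θ ∈ Γ, c ≤ heytingEval v θ := fun θ hθ => hc θ (.inr hθ)
    have hor : c ≤ heytingEval v φ ⊔ heytingEval v ψ := hc _ (.inl rfl)
    rw [← inf_eq_left.2 hor, inf_sup_left]
    exact sup_le (ih₁ _ (weaken hΓ inf_le_left inf_le_right))
      (ih₂ _ (weaken hΓ inf_le_left inf_le_right))
  | orE1 _ _ ih =>
    exact fun c hc => ih c <| weaken (fun ψ hψ => hc ψ (.inr hψ)) le_rfl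
      ((hc _ (.inl rfl)).trans le_sup_left)
  | orE2 _ _ ih =>
    exact fun c hc => ih c <| weaken (fun ψ hψ => hc ψ (.inr hψ)) le_rfl
      ((hc _ (.inl rfl)).trans le_sup_right)
  | impI _ _ ih =>
    exact fun c hc => le_himp_iff.2 (ih _ (weaken hc inf_le_left inf_le_right))
  | impE _ _ ih =>
    exact fun c hc => (le_inf le_rfl (hc _ (.inl rfl))).trans
      (le_himp_iff.1 (ih c fun ψ hψ => hc ψ (.inr hψ)))
  | @negI Γ φ ψ _ _ _ ih₁ ih₂ =>
    intro c hc
    have hw : ∀ θ ∈ insert φ Γ, c ⊓ heytingEval v φ ≤ heytingEval v θ :=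
      weaken hc inf_le_left inf_le_right
    refine le_compl_iff_disjoint_right.2 (disjoint_iff_inf_le.2 ?_)
    exact (le_inf (ih₁ _ hw) (ih₂ _ hw)).trans (inf_compl_self _).le
  | negE _ _ _ ih₁ ih₂ =>
    exact fun c hc => ((le_inf (ih₁ c hc) (ih₂ c hc)).trans (inf_compl_self _).le).trans bot_le

/-- The premises `(pᵢ → pⱼ) → p₀` for `i < j`: in a finite semantics they entail `p₀`,
although they do not do so intuitionistically. -/
def pigeonholePremises : Set PropForm :=
  {ψ | ∃ i j : ℕ, i < j ∧ ψ = .imp (.imp (.var i) (.var j)) (.var 0)}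

theorem not_deriv_pigeonholePremises (F : Set Conn) :
    ¬ Deriv F pigeonholePremises (.var 0) := by
  intro h
  let v : ℕ → ℕ∞ᵒᵈ := fun n => OrderDual.toDual ((n : ℕ∞) + 1)
  have key : (⊤ : ℕ∞ᵒᵈ) ≤ v 0 := by
    refine h.le_heytingEval v ⊤ ?_
    rintro _ ⟨i, j, hij, rfl⟩
    have hlt : ¬ v i ≤ v j := by
      change ¬ ((j : ℕ∞) + 1 ≤ (i : ℕ∞) + 1)
      norm_cast
      omega
    have hle : v j ≤ v 0 := by
      change ((0 : ℕ) : ℕ∞) + 1 ≤ (j : ℕ∞) + 1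
      norm_cast
      omega
    have himp : (v i ⇨ v j) ⊓ v i ≤ v j := himp_inf_le
    have hj : v i ⇨ v j ≤ v j := (inf_le_iff.1 himp).resolve_right hlt
    exact le_himp_iff.2 (inf_le_right.trans (hj.trans hle))
  have hzero : ((0 : ℕ) : ℕ∞) + 1 ≤ 0 := key
  simp at hzero

theorem deriv_of_imp_self {F : Set Conn} (hF : Conn.impl ∈ F) (φ ψ : PropForm) :
    Deriv F {.imp (.imp φ φ) ψ} ψ := by
  have hself : Deriv F ∅ (.imp φ φ) := .impI hF (.mem (.inl rfl))
  simpa using hself.cut (.impE hF (.mem (Set.mem_singleton (PropForm.imp (.imp φ φ) ψ))))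

theorem not_hasFiniteSemantics {F : Set Conn} (hF : Conn.impl ∈ F) :
    ¬ HasFiniteSemantics F := by
  rintro ⟨V, _, A, D, h⟩
  have hfrag (i j : ℕ) : InFrag F (.imp (.imp (.var i) (.var j)) (.var 0)) := by
    simp [InFrag, PropForm.conns, hF]
  have hvar : InFrag F (.var 0) := Set.empty_subset F
  refine not_deriv_pigeonholePremises F ((h _ _ ?_ hvar).2 ?_)
  · rintro _ ⟨i, j, -, rfl⟩
    exact hfrag i j
  · intro v hv
    obtain ⟨i, j, hij, heq⟩ : ∃ i j, i < j ∧ v i = v j := by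
      obtain ⟨i, j, hne, heq⟩ := Finite.exists_ne_map_eq_of_infinite v
      rcases hne.lt_or_gt with hlt | hlt
      exacts [⟨i, j, hlt, heq⟩, ⟨j, i, hlt, heq.symm⟩]
    refine (h {.imp (.imp (.var i) (.var i)) (.var 0)} _ ?_ hvar).1
      (deriv_of_imp_self hF _ _) v ?_
    · rintro _ rfl
      exact hfrag i i
    · rintro _ rfl
      simpa [Alg.eval, heq] using hv _ ⟨i, j, hij, rfl⟩

/-- Gödel: no fragment containing `→` has a finite semantics; in
particular full intuitionistic propositional logic has no finite semantics. -/
theorem no_finite_semantics_of_imp :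
    (∀ F : Set Conn, Conn.impl ∈ F → ¬ HasFiniteSemantics F) ∧
    ¬ HasFiniteSemantics (Set.univ : Set Conn) := by
  exact ⟨fun _ hF => not_hasFiniteSemantics hF, not_hasFiniteSemantics (Set.mem_univ _)⟩
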